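/- Let p ≥ 3 be an integer, Σ a symmetric invertible real p×p matrix, x, μ ∈ ℝ^p, and let j, k, l ∈ P = {1,…,p} be three pairwise distinct indices. Then the third-order Shapley interaction index of the game v(S) = md²(x̂^S) is zero: Σ_{T ⊆ P\{j,k,l}} (|T|!·(p − |T| − 3)!/(p − 2)!)·(Σ_{L ⊆ {j,k,l}} (−1)^{3−|L|} md²(x̂^{T∪L})) = 0. -/

import Mathlib

open Matrix Finset

/-- Squared Mahalanobis distance of `y` to `μ` with respect to `Sig`. -/
noncomputable def md2 {p : ℕ} (Sig : Matrix (Fin p) (Fin p) ℝ) (μ y : Fin p → ℝ) : ℝ :=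
  (y - μ) ⬝ᵥ (Sig⁻¹ *ᵥ (y - μ))

/-- The vector `x̂^S`, equal to `x` on coordinates in `S` and to `μ` elsewhere. -/
def xhat {p : ℕ} (x μ : Fin p → ℝ) (S : Finset (Fin p)) : Fin p → ℝ :=
  fun j => if j ∈ S then x j else μ j

theorem xhat_insert_sub {p : ℕ} (x μ : Fin p → ℝ) (S : Finset (Fin p)) (i : Fin p)
    (hi : i ∉ S) :
    xhat x μ (insert i S) - μ = (xhat x μ S - μ) + Pi.single i (x i - μ i) := by
  funext m
  by_cases h : m = i
  · subst h
    simp [xhat, hi]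
  · simp [xhat, h]

theorem third_order_shapley_interaction_vanishes {p : ℕ} (hp : 3 ≤ p)
    (Sig : Matrix (Fin p) (Fin p) ℝ) (hsym : Sig.IsSymm) (hinv : IsUnit Sig.det)
    (x μ : Fin p → ℝ) (j k l : Fin p)
    (hjk : j ≠ k) (hjl : j ≠ l) (hkl : k ≠ l) :
    ∑ T ∈ ((((Finset.univ : Finset (Fin p)).erase j).erase k).erase l).powerset,
        ((T.card.factorial * (p - T.card - 3).factorial : ℝ) / ((p - 2).factorial : ℝ)) *
          (∑ L ∈ ({j, k, l} : Finset (Fin p)).powerset,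
            (-1 : ℝ) ^ (3 - L.card) * md2 Sig μ (xhat x μ (T ∪ L)))
      = 0 := by
  apply Finset.sum_eq_zero
  intro T hT
  rw [Finset.mem_powerset] at hT
  have hj : j ∉ T := fun h => by simpa using hT h
  have hk : k ∉ T := fun h => by simpa using hT h
  have hl : l ∉ T := fun h => by simpa using hT h
  have key : (∑ L ∈ ({j, k, l} : Finset (Fin p)).powerset,
      (-1 : ℝ) ^ (3 - L.card) * md2 Sig μ (xhat x μ (T ∪ L))) = 0 := by
    have e : ({l} : Finset (Fin p)) = insert l ∅ := rfl
    rw [Finset.sum_powerset_insert (by simp [hjk, hjl]),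
      Finset.sum_powerset_insert (by simp [hkl]), Finset.sum_powerset_insert (by simp [hkl]), e,
      Finset.sum_powerset_insert (by simp), Finset.sum_powerset_insert (by simp),
      Finset.sum_powerset_insert (by simp), Finset.sum_powerset_insert (by simp)]
    simp only [Finset.powerset_empty, Finset.sum_singleton, Finset.union_insert,
      Finset.union_empty]
    have c1 : ∀ a : Fin p, (insert a (∅ : Finset (Fin p))).card = 1 := fun a => by simp
    have c2 : ∀ a b : Fin p, a ≠ b → (insert a (insert b (∅ : Finset (Fin p)))).card = 2 :=
      fun a b h => by simp [h]
    have c3 : (insert j (insert k (insert l (∅ : Finset (Fin p))))).card = 3 := by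
      simp [hjk, hjl, hkl]
    rw [c3, c2 _ _ hjk, c2 _ _ hjl, c2 _ _ hkl, c1, c1, c1, Finset.card_empty]
    unfold md2
    rw [xhat_insert_sub x μ (insert k (insert l T)) j (by simp [*]),
      xhat_insert_sub x μ (insert k T) j (by simp [*]),
      xhat_insert_sub x μ (insert l T) j (by simp [*]),
      xhat_insert_sub x μ (insert l T) k (by simp [*]),
      xhat_insert_sub x μ T j hj, xhat_insert_sub x μ T k hk, xhat_insert_sub x μ T l hl]
    simp only [Matrix.mulVec_add, add_dotProduct, dotProduct_add]
    ring
  rw [key, mul_zero]
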